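/- Assume the switching setup and that (C,A) ∈ ℝ^{m×n} × ℝ^{n×n} is observable (the matrix [Cᵀ, AᵀCᵀ, …, (Aᵀ)^{n−1}Cᵀ] has rank n). If every complex eigenvalue μ of A satisfies Re(μ) < −(ln δ)/T_c, then there exist an observer gain matrix L ∈ ℝ^{n×m} and constants C > 0, ϱ > 0 such that every differentiable function η̄ : [0,∞) → ℝ^{Nn} satisfying η̄′(t) = (I_N ⊗ A − H_{σ(j)} ⊗ LC) η̄(t) for every j ∈ ℕ and every t ∈ [t_j, t_{j+1}) satisfies ‖η̄(t)‖ ≤ C e^{−ϱt} ‖η̄(0)‖ for all t ≥ 0. (Exponentially convergent output-based distributed observer for an exponentially unstable leader over jointly connected switching networks.) -/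

import Mathlib

open Matrix NormedSpace Kronecker

/-- The operator norm of a square real matrix induced by the Euclidean vector norm. -/
noncomputable def opNorm {k : Type*} [Fintype k] [DecidableEq k] (M : Matrix k k ℝ) : ℝ :=
  ‖Matrix.toEuclideanCLM (𝕜 := ℝ) M‖

/-- The product `f (b-1) * f (b-2) * ⋯ * f a` (the identity if `b ≤ a`):
later factors multiply on the left. -/
def descProd {R : Type*} [Monoid R] (f : ℕ → R) (a b : ℕ) : R :=
  ((List.range (b - a)).map (fun i => f (b - 1 - i))).prod

/-- The observability matrix `[Cᵀ, AᵀCᵀ, …, (Aᵀ)^{n-1}Cᵀ]` of the pair `(C, A)`. -/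
def obsvMatrix {n m : ℕ} (A : Matrix (Fin n) (Fin n) ℝ) (C : Matrix (Fin m) (Fin n) ℝ) :
    Matrix (Fin n) (Fin n × Fin m) ℝ :=
  Matrix.of fun i p => ((Aᵀ) ^ (p.1 : ℕ) * Cᵀ) i p.2

/-- The Euclidean norm of a finitely indexed real vector. -/
noncomputable def eNorm {ι : Type*} [Fintype ι] (v : ι → ℝ) : ℝ :=
  Real.sqrt (∑ i, v i ^ 2)

section EuclideanNorm

variable {ι κ : Type*} [Fintype ι] [Fintype κ]

theorem eNorm_eq_norm (v : ι → ℝ) : eNorm v = ‖WithLp.toLp 2 v‖ := by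
  simp [eNorm, EuclideanSpace.norm_eq]

theorem eNorm_nonneg (v : ι → ℝ) : 0 ≤ eNorm v := Real.sqrt_nonneg _

theorem eNorm_sq (v : ι → ℝ) : eNorm v ^ 2 = v ⬝ᵥ v := by
  rw [eNorm, Real.sq_sqrt (Finset.sum_nonneg fun i _ => sq_nonneg _)]
  simp [dotProduct, sq]

theorem dotProduct_self_nonneg_real (v : ι → ℝ) : 0 ≤ v ⬝ᵥ v := by
  rw [← eNorm_sq]; positivity

theorem eNorm_add_le (v w : ι → ℝ) : eNorm (v + w) ≤ eNorm v + eNorm w := by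
  simp only [eNorm_eq_norm, WithLp.toLp_add]; exact norm_add_le _ _

theorem eNorm_le_of_dotProduct_le {v : ι → ℝ} {w : κ → ℝ} {c : ℝ} (hc : 0 ≤ c)
    (h : v ⬝ᵥ v ≤ c ^ 2 * (w ⬝ᵥ w)) : eNorm v ≤ c * eNorm w := by
  refine le_of_sq_le_sq ?_ (mul_nonneg hc (eNorm_nonneg _))
  rw [mul_pow, eNorm_sq, eNorm_sq]; exact h

theorem dotProduct_le_eNorm_mul (v w : ι → ℝ) : v ⬝ᵥ w ≤ eNorm v * eNorm w := by
  have := real_inner_le_norm (WithLp.toLp 2 w) (WithLp.toLp 2 v)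
  rw [EuclideanSpace.inner_toLp_toLp] at this
  rw [eNorm_eq_norm, eNorm_eq_norm, mul_comm]
  simpa using this

/-- A symmetric idempotent matrix is an orthogonal projection, hence a contraction. -/
theorem eNorm_mulVec_le_of_isSymm_of_idem {Q : Matrix ι ι ℝ} (hs : Qᵀ = Q) (hi : Q * Q = Q)
    (v : ι → ℝ) : eNorm (Q *ᵥ v) ≤ eNorm v := by
  have h1 : (Q *ᵥ v) ⬝ᵥ (Q *ᵥ v) = v ⬝ᵥ Q *ᵥ v := by
    rw [dotProduct_mulVec, ← mulVec_transpose, hs, mulVec_mulVec, hi, dotProduct_comm]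
  have h2 := dotProduct_self_nonneg_real (v - Q *ᵥ v)
  have h3 : (Q *ᵥ v) ⬝ᵥ v = v ⬝ᵥ Q *ᵥ v := dotProduct_comm _ _
  simp only [sub_dotProduct, dotProduct_sub] at h2
  have := eNorm_le_of_dotProduct_le (v := Q *ᵥ v) (w := v) (c := 1) zero_le_one (by linarith)
  simpa using this

/-- A quadratic form that is positive on the nonzero vectors of a subspace is uniformly so. -/
theorem exists_pos_mul_le_dotProduct_mulVec (M : Matrix ι ι ℝ) (S : Submodule ℝ (ι → ℝ))
    (h : ∀ x ∈ S, x ≠ 0 → 0 < x ⬝ᵥ M *ᵥ x) :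
    ∃ c > 0, ∀ x ∈ S, c * (x ⬝ᵥ x) ≤ x ⬝ᵥ M *ᵥ x := by
  have hcont : Continuous fun x : ι → ℝ => x ⬝ᵥ M *ᵥ x := by fun_prop
  have hK : IsCompact (Metric.sphere (0 : ι → ℝ) 1 ∩ (S : Set (ι → ℝ))) :=
    (isCompact_sphere _ _).inter_right S.closed_of_finiteDimensional
  obtain ⟨c, hc, hcK⟩ : ∃ c > 0, ∀ x ∈ Metric.sphere (0 : ι → ℝ) 1 ∩ (S : Set (ι → ℝ)),
      c ≤ x ⬝ᵥ M *ᵥ x := by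
    rcases (Metric.sphere (0 : ι → ℝ) 1 ∩ (S : Set (ι → ℝ))).eq_empty_or_nonempty with he | hne
    · exact ⟨1, one_pos, by simp [he]⟩
    · obtain ⟨x, hx, hmin⟩ := hK.exists_isMinOn hne hcont.continuousOn
      refine ⟨_, h x hx.2 ?_, hmin⟩
      rintro rfl
      simpa using hx.1
  have hcard : 0 < (Fintype.card ι : ℝ) + 1 := by positivity
  refine ⟨c / (Fintype.card ι + 1), by positivity, fun x hx => ?_⟩
  by_cases hx0 : x = 0
  · simp [hx0]
  have hn : 0 < ‖x‖ := norm_pos_iff.2 hx0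
  have h1 := hcK (‖x‖⁻¹ • x) ⟨by simp [norm_smul, hn.ne'], S.smul_mem _ hx⟩
  have h2 : x ⬝ᵥ x ≤ (Fintype.card ι + 1) * ‖x‖ ^ 2 := by
    have : x ⬝ᵥ x ≤ ∑ _i : ι, ‖x‖ ^ 2 := by
      refine Finset.sum_le_sum fun i _ => ?_
      rw [← sq, ← sq_abs]
      exact pow_le_pow_left₀ (abs_nonneg _) (norm_le_pi_norm x i) 2
    simp only [Finset.sum_const, Finset.card_univ, nsmul_eq_mul] at this
    nlinarith [sq_nonneg ‖x‖]
  rw [mulVec_smul, smul_dotProduct, dotProduct_smul, smul_eq_mul, smul_eq_mul, ← mul_assoc,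
    ← mul_inv, ← sq, ← div_eq_inv_mul, le_div_iff₀ (by positivity)] at h1
  calc _ ≤ c / (Fintype.card ι + 1) * ((Fintype.card ι + 1) * ‖x‖ ^ 2) := by gcongr
    _ = c * ‖x‖ ^ 2 := by field_simp
    _ ≤ _ := h1

variable [DecidableEq ι]

theorem opNorm_nonneg (M : Matrix ι ι ℝ) : 0 ≤ opNorm M := norm_nonneg _

theorem eNorm_mulVec_le (M : Matrix ι ι ℝ) (v : ι → ℝ) :
    eNorm (M *ᵥ v) ≤ opNorm M * eNorm v := by
  rw [eNorm_eq_norm, eNorm_eq_norm, ← toEuclideanCLM_toLp]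
  exact ContinuousLinearMap.le_opNorm _ _

theorem dotProduct_mulVec_le (M : Matrix ι ι ℝ) (v : ι → ℝ) :
    v ⬝ᵥ M *ᵥ v ≤ opNorm M * (v ⬝ᵥ v) := by
  refine (dotProduct_le_eNorm_mul _ _).trans ?_
  have := mul_le_mul_of_nonneg_left (eNorm_mulVec_le M v) (eNorm_nonneg v)
  rw [← eNorm_sq]; nlinarith

end EuclideanNorm

section ExponentialGrowth

variable {ι : Type*} [Fintype ι] [DecidableEq ι]

theorem exp_smul_mulVec_of_pow_mulVec_eq_zero (B : Matrix ι ι ℂ) (μ : ℂ) (v : ι → ℂ) (k : ℕ)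
    (h : (B - μ • 1) ^ k *ᵥ v = 0) (t : ℝ) :
    exp (t • B) *ᵥ v = Complex.exp (t * μ) •
      ∑ i ∈ Finset.range k, (((i.factorial : ℂ)⁻¹ * (t : ℂ) ^ i) • ((B - μ • 1) ^ i *ᵥ v)) := by
  set D := B - μ • (1 : Matrix ι ι ℂ) with hD
  have hB : t • B = ((t : ℂ) * μ) • (1 : Matrix ι ι ℂ) + (t : ℂ) • D := by
    rw [hD, smul_sub, smul_smul, add_sub_cancel, Complex.coe_smul]
  have hcomm : Commute (((t : ℂ) * μ) • (1 : Matrix ι ι ℂ)) ((t : ℂ) • D) :=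
    (Commute.one_left _).smul_left _
  have hscal : exp (((t : ℂ) * μ) • (1 : Matrix ι ι ℂ)) =
      Complex.exp (t * μ) • (1 : Matrix ι ι ℂ) := by
    rw [smul_one_eq_diagonal, exp_diagonal, smul_one_eq_diagonal]
    congr 1
    ext i
    rw [Pi.coe_exp, Complex.exp_eq_exp_ℂ]
  have hsum : HasSum (fun i : ℕ => ((i.factorial : ℂ)⁻¹ • ((t : ℂ) • D) ^ i) *ᵥ v)
      (exp ((t : ℂ) • D) *ᵥ v) := by
    have : HasSum (fun i : ℕ => (i.factorial : ℂ)⁻¹ • ((t : ℂ) • D) ^ i) (exp ((t : ℂ) • D)) := by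
      open scoped Norms.Operator in exact exp_series_hasSum_exp' (𝕂 := ℂ) ((t : ℂ) • D)
    exact this.map (AddMonoidHom.mk' (fun M : Matrix ι ι ℂ => M *ᵥ v) fun _ _ => add_mulVec _ _ _)
      (by change Continuous fun M : Matrix ι ι ℂ => M *ᵥ v; fun_prop)
  have hfin : exp ((t : ℂ) • D) *ᵥ v =
      ∑ i ∈ Finset.range k, ((i.factorial : ℂ)⁻¹ • ((t : ℂ) • D) ^ i) *ᵥ v := by
    refine hsum.unique (hasSum_sum_of_ne_finset_zero fun i hi => ?_)
    obtain ⟨l, rfl⟩ := Nat.exists_eq_add_of_le' (not_lt.1 (Finset.mem_range.not.1 hi))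
    rw [smul_pow, pow_add D, smul_mulVec, smul_mulVec, ← mulVec_mulVec, h]
    simp
  rw [hB, exp_add_of_commute _ _ hcomm, hscal, ← mulVec_mulVec, hfin, smul_mulVec, one_mulVec]
  simp only [smul_pow, smul_mulVec, smul_smul]

theorem exists_norm_exp_smul_mulVec_le (B : Matrix ι ι ℂ) {α : ℝ}
    (hα : ∀ μ : ℂ, (∃ v : ι → ℂ, v ≠ 0 ∧ B *ᵥ v = μ • v) → μ.re < α) (v : ι → ℂ) :
    ∃ K : ℝ, ∀ t : ℝ, 0 ≤ t → ‖exp (t • B) *ᵥ v‖ ≤ K * Real.exp (α * t) := by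
  let S : Submodule ℂ (ι → ℂ) :=
    { carrier := {v | ∃ K : ℝ, ∀ t : ℝ, 0 ≤ t → ‖exp (t • B) *ᵥ v‖ ≤ K * Real.exp (α * t)}
      zero_mem' := ⟨0, by simp⟩
      add_mem' := by
        rintro x y ⟨K, hK⟩ ⟨K', hK'⟩
        refine ⟨K + K', fun t ht => ?_⟩
        rw [mulVec_add, add_mul]
        exact (norm_add_le _ _).trans (add_le_add (hK t ht) (hK' t ht))
      smul_mem' := by
        rintro c x ⟨K, hK⟩
        refine ⟨‖c‖ * K, fun t ht => ?_⟩
        rw [mulVec_smul, norm_smul, mul_assoc]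
        exact mul_le_mul_of_nonneg_left (hK t ht) (norm_nonneg _) }
  suffices hS : S = ⊤ by
    have : v ∈ S := hS ▸ Submodule.mem_top
    exact this
  rw [eq_top_iff, ← Module.End.iSup_maxGenEigenspace_eq_top (Matrix.toLin' B)]
  refine iSup_le fun μ w hw => ?_
  obtain ⟨k, hk⟩ := Module.End.mem_maxGenEigenspace _ _ _ |>.1 hw
  have hpow : (B - μ • 1) ^ k *ᵥ w = 0 := by
    rw [← hk, ← Matrix.toLin'_apply, Matrix.toLin'_pow, map_sub, map_smul, Matrix.toLin'_one]
    rfl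
  rcases eq_or_ne w 0 with rfl | hw0
  · exact S.zero_mem
  have hμ : μ.re < α := by
    refine hα μ ?_
    have hev : Module.End.HasUnifEigenvalue (Matrix.toLin' B) μ ⊤ := by
      intro hbot
      apply hw0
      have : w ∈ (⊥ : Submodule ℂ (ι → ℂ)) := hbot ▸ hw
      simpa using this
    obtain ⟨x, hx⟩ := Module.End.HasEigenvalue.exists_hasEigenvector (hev.lt zero_lt_one)
    exact ⟨x, hx.2, hx.apply_eq_smul⟩
  have hβ : 0 < α - μ.re := sub_pos.2 hμ
  refine ⟨∑ i ∈ Finset.range k, ((α - μ.re) ^ i)⁻¹ * ‖(B - μ • 1) ^ i *ᵥ w‖, fun t ht => ?_⟩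
  rw [exp_smul_mulVec_of_pow_mulVec_eq_zero B μ w k hpow t, norm_smul, Complex.norm_exp,
    Finset.sum_mul]
  refine (mul_le_mul_of_nonneg_left (norm_sum_le _ _) (Real.exp_nonneg _)).trans ?_
  rw [Finset.mul_sum]
  refine Finset.sum_le_sum fun i _ => ?_
  have h1 : t ^ i / i.factorial ≤ ((α - μ.re) ^ i)⁻¹ * Real.exp ((α - μ.re) * t) := by
    rw [← div_eq_inv_mul, le_div_iff₀ (by positivity)]
    have := Real.pow_div_factorial_le_exp _ (mul_nonneg hβ.le ht) i
    rw [mul_pow] at this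
    exact le_of_eq_of_le (by ring) this
  have h2 : Real.exp (α * t) = Real.exp ((t : ℂ) * μ).re * Real.exp ((α - μ.re) * t) := by
    rw [← Real.exp_add]; congr 1; simp; ring
  rw [norm_smul, norm_mul, norm_inv, norm_pow, Complex.norm_real, Real.norm_of_nonneg ht,
    Complex.norm_natCast, h2, ← div_eq_inv_mul]
  calc _ ≤ Real.exp ((t : ℂ) * μ).re * ((((α - μ.re) ^ i)⁻¹ * Real.exp ((α - μ.re) * t)) *
        ‖(B - μ • 1) ^ i *ᵥ w‖) := by gcongr
    _ = _ := by ring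

/-- If all complex eigenvalues of `B` have real part `< α`, then `‖e^{Bt}‖ = O(e^{αt})`. -/
theorem exists_opNorm_exp_smul_le (B : Matrix ι ι ℝ) {α : ℝ}
    (hα : ∀ μ : ℂ, (∃ v : ι → ℂ, v ≠ 0 ∧ (B.map Complex.ofReal) *ᵥ v = μ • v) → μ.re < α) :
    ∃ M : ℝ, 1 ≤ M ∧ ∀ t : ℝ, 0 ≤ t → opNorm (exp (t • B)) ≤ M * Real.exp (α * t) := by
  have hmap : ∀ (t : ℝ) (v : ι → ℝ), exp (t • B.map Complex.ofReal) *ᵥ (Complex.ofReal ∘ v) =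
      Complex.ofReal ∘ (exp (t • B) *ᵥ v) := by
    intro t v
    have h1 : exp (t • B.map Complex.ofReal) = (exp (t • B)).map Complex.ofReal := by
      have hc : Continuous (Complex.ofRealHom.mapMatrix : Matrix ι ι ℝ →+* Matrix ι ι ℂ) :=
        continuous_id.matrix_map Complex.continuous_ofReal
      have := open scoped Norms.Operator in
        NormedSpace.map_exp (Complex.ofRealHom.mapMatrix : Matrix ι ι ℝ →+* Matrix ι ι ℂ) hc (t • B)
      rw [RingHom.mapMatrix_apply, RingHom.mapMatrix_apply] at this
      refine Eq.trans ?_ this.symm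
      congr 1
      ext i j
      simp
    rw [h1]
    ext i
    exact (Complex.ofRealHom.map_mulVec _ _ _).symm
  let g : {t : ℝ // 0 ≤ t} → EuclideanSpace ℝ ι →L[ℝ] EuclideanSpace ℝ ι := fun t =>
    Real.exp (-(α * t)) • toEuclideanCLM (𝕜 := ℝ) (exp ((t : ℝ) • B))
  obtain ⟨M, hM⟩ : ∃ M, ∀ t, ‖g t‖ ≤ M := by
    refine banach_steinhaus fun x => ?_
    obtain ⟨K, hK⟩ := exists_norm_exp_smul_mulVec_le _ hα (Complex.ofReal ∘ WithLp.ofLp x)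
    let e := (EuclideanSpace.equiv ι ℝ).symm.toContinuousLinearMap
    refine ⟨‖e‖ * K, fun t => ?_⟩
    have h1 := hK t t.2
    rw [hmap] at h1
    have h2 : ‖Complex.ofReal ∘ (exp ((t : ℝ) • B) *ᵥ WithLp.ofLp x)‖ =
        ‖exp ((t : ℝ) • B) *ᵥ WithLp.ofLp x‖ := by
      simp [Pi.norm_def]
    rw [h2] at h1
    have h3 : ‖toEuclideanCLM (𝕜 := ℝ) (exp ((t : ℝ) • B)) x‖ ≤
        ‖e‖ * ‖exp ((t : ℝ) • B) *ᵥ WithLp.ofLp x‖ := e.le_opNorm _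
    change ‖Real.exp (-(α * t)) • toEuclideanCLM (𝕜 := ℝ) (exp ((t : ℝ) • B)) x‖ ≤ _
    rw [norm_smul, Real.norm_of_nonneg (Real.exp_nonneg _), Real.exp_neg, ← div_eq_inv_mul,
      div_le_iff₀ (Real.exp_pos _)]
    refine h3.trans ?_
    rw [mul_assoc]
    exact mul_le_mul_of_nonneg_left h1 (norm_nonneg _)
  refine ⟨max M 1, le_max_right _ _, fun t ht => ?_⟩
  have h1 := (hM ⟨t, ht⟩).trans (le_max_left M 1)
  change ‖Real.exp (-(α * t)) • toEuclideanCLM (𝕜 := ℝ) (exp (t • B))‖ ≤ _ at h1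
  rwa [norm_smul, Real.norm_of_nonneg (Real.exp_nonneg _), Real.exp_neg, ← div_eq_inv_mul,
      div_le_iff₀ (Real.exp_pos _)] at h1

end ExponentialGrowth

section LinearODE

variable {ι κ : Type*} [Fintype ι] [Fintype κ]

theorem HasDerivAt.matrix_mulVec {x : ℝ → ι → ℝ} {x' : ι → ℝ} {t : ℝ}
    (hx : HasDerivAt x x' t) (M : Matrix κ ι ℝ) :
    HasDerivAt (fun t => M *ᵥ x t) (M *ᵥ x') t :=
  M.mulVecLin.toContinuousLinearMap.hasFDerivAt.comp_hasDerivAt t hx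

theorem HasDerivAt.dotProduct_real {x y : ℝ → ι → ℝ} {x' y' : ι → ℝ} {t : ℝ}
    (hx : HasDerivAt x x' t) (hy : HasDerivAt y y' t) :
    HasDerivAt (fun t => x t ⬝ᵥ y t) (x' ⬝ᵥ y t + x t ⬝ᵥ y') t := by
  simp only [dotProduct, ← Finset.sum_add_distrib]
  exact HasDerivAt.fun_sum fun i _ => (hasDerivAt_pi.1 hx i).mul (hasDerivAt_pi.1 hy i)

theorem dotProduct_mulVec_le_exp_mul {M : Matrix ι ι ℝ} {x x' : ℝ → ι → ℝ} {a b c : ℝ}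
    (hab : a ≤ b) (hcont : ContinuousOn x (Set.Icc a b))
    (hx : ∀ t ∈ Set.Ioo a b, HasDerivAt x (x' t) t)
    (hle : ∀ t ∈ Set.Ioo a b,
      x' t ⬝ᵥ M *ᵥ x t + x t ⬝ᵥ M *ᵥ x' t ≤ c * (x t ⬝ᵥ M *ᵥ x t)) :
    x b ⬝ᵥ M *ᵥ x b ≤ Real.exp (c * (b - a)) * (x a ⬝ᵥ M *ᵥ x a) := by
  have hd : ∀ t ∈ Set.Ioo a b, HasDerivAt (fun t => Real.exp (-c * t) * (x t ⬝ᵥ M *ᵥ x t))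
      (Real.exp (-c * t) * (-c * 1) * (x t ⬝ᵥ M *ᵥ x t) +
        Real.exp (-c * t) * (x' t ⬝ᵥ M *ᵥ x t + x t ⬝ᵥ M *ᵥ x' t)) t := fun t ht =>
    (((hasDerivAt_id t).const_mul (-c)).exp).mul
      ((hx t ht).dotProduct_real ((hx t ht).matrix_mulVec M))
  have hanti : AntitoneOn (fun t => Real.exp (-c * t) * (x t ⬝ᵥ M *ᵥ x t)) (Set.Icc a b) := by
    refine antitoneOn_of_deriv_nonpos (convex_Icc a b) ?_ ?_ ?_
    · have hq : Continuous fun v : ι → ℝ => v ⬝ᵥ M *ᵥ v := by fun_prop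
      exact (by fun_prop : Continuous fun t : ℝ => Real.exp (-c * t)).continuousOn.mul
        (hq.comp_continuousOn hcont)
    · rw [interior_Icc]
      exact fun t ht => (hd t ht).differentiableAt.differentiableWithinAt
    · rw [interior_Icc]
      intro t ht
      rw [(hd t ht).deriv]
      have := mul_le_mul_of_nonneg_left (hle t ht) (Real.exp_nonneg (-c * t))
      linarith
  have h := hanti (Set.left_mem_Icc.2 hab) (Set.right_mem_Icc.2 hab) hab
  simp only [neg_mul, Real.exp_neg] at h
  rw [inv_mul_le_iff₀ (Real.exp_pos _)] at h
  refine h.trans (le_of_eq ?_)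
  rw [mul_sub, Real.exp_sub]
  ring

variable [DecidableEq ι]

theorem eNorm_le_exp_mul_of_linear {B : ℝ → Matrix ι ι ℝ} {x : ℝ → ι → ℝ} {a b c : ℝ}
    (hab : a ≤ b) (hcont : ContinuousOn x (Set.Icc a b))
    (hx : ∀ t ∈ Set.Ioo a b, HasDerivAt x (B t *ᵥ x t) t)
    (hB : ∀ t ∈ Set.Ioo a b, opNorm (B t) ≤ c) :
    eNorm (x b) ≤ Real.exp (c * (b - a)) * eNorm (x a) := by
  refine eNorm_le_of_dotProduct_le (Real.exp_nonneg _) ?_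
  have := dotProduct_mulVec_le_exp_mul (M := 1) (c := 2 * c) hab hcont hx fun t ht => by
    have h1 := dotProduct_mulVec_le (B t) (x t)
    have h2 := mul_le_mul_of_nonneg_right (hB t ht) (dotProduct_self_nonneg_real (x t))
    rw [one_mulVec, one_mulVec, dotProduct_comm]
    linarith
  rw [one_mulVec, one_mulVec] at this
  rw [← Real.exp_nat_mul]
  refine this.trans (le_of_eq ?_)
  congr 2
  push_cast
  ring

theorem hasDerivAt_exp_smul_mulVec (B : Matrix ι ι ℝ) (v : ι → ℝ) (t : ℝ) :
    HasDerivAt (fun t : ℝ => exp (t • B) *ᵥ v) (B *ᵥ (exp (t • B) *ᵥ v)) t := by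
  open scoped Norms.Operator in
  have h := hasDerivAt_exp_smul_const' (𝕂 := ℝ) B t
  rw [mulVec_mulVec]
  let ev : Matrix ι ι ℝ →ₗ[ℝ] (ι → ℝ) :=
    { toFun := fun M => M *ᵥ v
      map_add' := fun _ _ => add_mulVec _ _ _
      map_smul' := fun _ _ => smul_mulVec _ _ _ }
  exact ev.toContinuousLinearMap.hasFDerivAt.comp_hasDerivAt t h

theorem exp_add_smul_mulVec (B : Matrix ι ι ℝ) (s t : ℝ) (v : ι → ℝ) :
    exp ((s + t) • B) *ᵥ v = exp (s • B) *ᵥ (exp (t • B) *ᵥ v) := by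
  rw [add_smul, exp_add_of_commute _ _ (((Commute.refl B).smul_left s).smul_right t),
    mulVec_mulVec]

theorem eq_exp_smul_mulVec_of_hasDerivAt {B : Matrix ι ι ℝ} {y : ℝ → ι → ℝ} {a b : ℝ}
    (hab : a ≤ b) (hcont : ContinuousOn y (Set.Icc a b))
    (hy : ∀ t ∈ Set.Ioo a b, HasDerivAt y (B *ᵥ y t) t) :
    y b = exp ((b - a) • B) *ᵥ y a := by
  have he : ∀ t, HasDerivAt (fun t : ℝ => exp ((t - a) • B) *ᵥ y a)
      (B *ᵥ (exp ((t - a) • B) *ᵥ y a)) t := fun t =>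
    (hasDerivAt_exp_smul_mulVec B (y a) (t - a)).comp_sub_const t a
  have h := eNorm_le_exp_mul_of_linear (B := fun _ => B) (c := opNorm B)
    (x := fun t => y t - exp ((t - a) • B) *ᵥ y a) hab
    (hcont.sub fun t _ => (he t).continuousAt.continuousWithinAt)
    (fun t ht => by rw [mulVec_sub]; exact (hy t ht).sub (he t)) fun _ _ => le_rfl
  have h0 : eNorm (y b - exp ((b - a) • B) *ᵥ y a) ≤ 0 := by
    refine h.trans (le_of_eq ?_)
    simp [eNorm]
  rw [eNorm_eq_norm, norm_le_zero_iff, WithLp.toLp_eq_zero] at h0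
  exact sub_eq_zero.1 h0

end LinearODE

section AdaptedNorm

variable {ι : Type*} [Fintype ι] [DecidableEq ι]

/-- A norm equivalent to the Euclidean one for which `e^{Bs}` has norm at most `e^{αs}`, and which
is still compatible with operators commuting with `B`. -/
theorem exists_adapted_norm {B : Matrix ι ι ℝ} {α M : ℝ}
    (hM : ∀ t : ℝ, 0 ≤ t → opNorm (exp (t • B)) ≤ M * Real.exp (α * t)) :
    ∃ f : (ι → ℝ) → ℝ, (∀ x, eNorm x ≤ f x) ∧ (∀ x, f x ≤ M * eNorm x) ∧
      (∀ x y, f (x + y) ≤ f x + f y) ∧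
      (∀ s, 0 ≤ s → ∀ x, f (exp (s • B) *ᵥ x) ≤ Real.exp (α * s) * f x) ∧
      ∀ (Q : Matrix ι ι ℝ) (q : ℝ), Commute Q B → 0 ≤ q →
        (∀ x, eNorm (Q *ᵥ x) ≤ q * eNorm x) → ∀ x, f (Q *ᵥ x) ≤ q * f x := by
  let g : (ι → ℝ) → {t : ℝ // 0 ≤ t} → ℝ := fun x t =>
    Real.exp (-(α * t)) * eNorm (exp ((t : ℝ) • B) *ᵥ x)
  have hg : ∀ x t, g x t ≤ M * eNorm x := by
    intro x t
    have h := (eNorm_mulVec_le (exp ((t : ℝ) • B)) x).trans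
      (mul_le_mul_of_nonneg_right (hM t t.2) (eNorm_nonneg x))
    change Real.exp (-(α * t)) * _ ≤ _
    rw [Real.exp_neg, inv_mul_le_iff₀ (Real.exp_pos _)]
    linarith
  have hbdd : ∀ x, BddAbove (Set.range (g x)) := fun x => ⟨_, by rintro _ ⟨t, rfl⟩; exact hg x t⟩
  have : Nonempty {t : ℝ // 0 ≤ t} := ⟨⟨0, le_rfl⟩⟩
  refine ⟨fun x => ⨆ t, g x t, fun x => ?_, fun x => ciSup_le (hg x), fun x y => ?_,
    fun s hs x => ?_, fun Q q hQ hq hQn x => ?_⟩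
  · refine le_of_eq_of_le ?_ (le_ciSup (hbdd x) ⟨0, le_rfl⟩)
    simp [g]
  · refine ciSup_le fun t => ?_
    refine le_trans ?_ (add_le_add (le_ciSup (hbdd x) t) (le_ciSup (hbdd y) t))
    simp only [g]
    rw [← mul_add, mulVec_add]
    exact mul_le_mul_of_nonneg_left (eNorm_add_le _ _) (Real.exp_nonneg _)
  · refine ciSup_le fun t => ?_
    refine le_trans (le_of_eq ?_) (mul_le_mul_of_nonneg_left
      (le_ciSup (hbdd x) ⟨t + s, add_nonneg t.2 hs⟩) (Real.exp_nonneg _))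
    simp only [g]
    rw [exp_add_smul_mulVec, ← mul_assoc, ← Real.exp_add]
    congr 2
    ring
  · refine ciSup_le fun t => ?_
    refine le_trans ?_ (mul_le_mul_of_nonneg_left (le_ciSup (hbdd x) t) hq)
    simp only [g]
    have hc : exp ((t : ℝ) • B) *ᵥ (Q *ᵥ x) = Q *ᵥ (exp ((t : ℝ) • B) *ᵥ x) := by
      rw [mulVec_mulVec, mulVec_mulVec, ((hQ.smul_right (t : ℝ)).exp_right).eq]
    rw [hc]
    have := mul_le_mul_of_nonneg_left (hQn (exp ((t : ℝ) • B) *ᵥ x))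
      (Real.exp_nonneg (-(α * t)))
    linarith

end AdaptedNorm

section Gramian

theorem dotProduct_integral_mulVec {ι : Type*} [Fintype ι] {G : ℝ → Matrix ι ι ℝ}
    (hG : Continuous G) (a b : ℝ) (x y : ι → ℝ) :
    x ⬝ᵥ (Matrix.of fun i j => ∫ s in a..b, G s i j) *ᵥ y = ∫ s in a..b, x ⬝ᵥ G s *ᵥ y := by
  have hc : ∀ i j, Continuous fun s => G s i j := fun i j => hG.matrix_elem i j
  simp only [dotProduct, mulVec, of_apply]
  have hi : ∀ i, Continuous fun s => ∑ j, G s i j * y j := fun i =>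
    continuous_finsetSum _ fun j _ => (hc i j).mul continuous_const
  rw [intervalIntegral.integral_finsetSum (f := fun i s => x i * ∑ j, G s i j * y j)
    fun i _ => ((hi i).const_mul (x i)).intervalIntegrable _ _]
  refine Finset.sum_congr rfl fun i _ => ?_
  rw [intervalIntegral.integral_const_mul, intervalIntegral.integral_finsetSum
    (f := fun j s => G s i j * y j) fun j _ => ((hc i j).mul_const (y j)).intervalIntegrable _ _]
  simp only [intervalIntegral.integral_mul_const]

variable {ι κ : Type*} [Fintype ι] [Fintype κ] [DecidableEq ι]

/-- The integrand of the exponentially weighted observability Gramian of `(C, A)`. -/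
noncomputable def gramianIntegrand (A : Matrix ι ι ℝ) (C : Matrix κ ι ℝ) (γ s : ℝ) :
    Matrix ι ι ℝ :=
  Real.exp (-(2 * γ) * s) • ((C * exp ((-s) • A))ᵀ * (C * exp ((-s) • A)))

/-- The exponentially weighted observability Gramian of `(C, A)` on `[0, h]`. -/
noncomputable def gramian (A : Matrix ι ι ℝ) (C : Matrix κ ι ℝ) (γ h : ℝ) : Matrix ι ι ℝ :=
  Matrix.of fun i j => ∫ s in (0 : ℝ)..h, gramianIntegrand A C γ s i j

variable (A : Matrix ι ι ℝ) (C : Matrix κ ι ℝ)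

theorem continuous_exp_smul : Continuous fun t : ℝ => exp (t • A) := by
  open scoped Norms.Operator in
  exact continuous_iff_continuousAt.2 fun t =>
    (hasDerivAt_exp_smul_const' (𝕂 := ℝ) A t).continuousAt

theorem continuous_gramianIntegrand (γ : ℝ) : Continuous (gramianIntegrand A C γ) := by
  have hE : Continuous fun s : ℝ => C * exp ((-s) • A) :=
    continuous_const.matrix_mul ((continuous_exp_smul A).comp continuous_neg)
  have he : Continuous fun s : ℝ => Real.exp (-(2 * γ) * s) := by fun_prop
  exact he.smul (hE.matrix_transpose.matrix_mul hE)

theorem dotProduct_gramianIntegrand_mulVec (γ s : ℝ) (x y : ι → ℝ) :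
    x ⬝ᵥ gramianIntegrand A C γ s *ᵥ y = Real.exp (-(2 * γ) * s) *
      ((C *ᵥ (exp ((-s) • A) *ᵥ x)) ⬝ᵥ (C *ᵥ (exp ((-s) • A) *ᵥ y))) := by
  rw [gramianIntegrand, smul_mulVec, dotProduct_smul, smul_eq_mul, ← mulVec_mulVec,
    dotProduct_mulVec, vecMul_transpose, mulVec_mulVec, mulVec_mulVec]

theorem dotProduct_gramian_mulVec (γ h : ℝ) (x y : ι → ℝ) :
    x ⬝ᵥ gramian A C γ h *ᵥ y = ∫ s in (0 : ℝ)..h, Real.exp (-(2 * γ) * s) *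
      ((C *ᵥ (exp ((-s) • A) *ᵥ x)) ⬝ᵥ (C *ᵥ (exp ((-s) • A) *ᵥ y))) := by
  rw [gramian, dotProduct_integral_mulVec (continuous_gramianIntegrand A C γ)]
  simp only [dotProduct_gramianIntegrand_mulVec]

theorem continuous_gramian_form (γ : ℝ) (x y : ι → ℝ) :
    Continuous fun s : ℝ => Real.exp (-(2 * γ) * s) *
      ((C *ᵥ (exp ((-s) • A) *ᵥ x)) ⬝ᵥ (C *ᵥ (exp ((-s) • A) *ᵥ y))) := by
  simp only [← dotProduct_gramianIntegrand_mulVec]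
  exact continuous_const.dotProduct
    ((continuous_gramianIntegrand A C γ).matrix_mulVec continuous_const)

theorem transpose_gramian (γ h : ℝ) : (gramian A C γ h)ᵀ = gramian A C γ h := by
  have : ∀ s, (gramianIntegrand A C γ s)ᵀ = gramianIntegrand A C γ s := fun s => by
    simp [gramianIntegrand, transpose_mul]
  ext i j
  simp only [gramian, transpose_apply, of_apply]
  congr 1
  ext s
  exact congrFun (congrFun (this s) i) j

theorem hasDerivAt_exp_neg_smul_mulVec (x : ι → ℝ) (s : ℝ) :
    HasDerivAt (fun s : ℝ => exp ((-s) • A) *ᵥ x) (-(exp ((-s) • A) *ᵥ (A *ᵥ x))) s := by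
  have h := (hasDerivAt_exp_smul_mulVec A x (-s)).scomp s (hasDerivAt_neg s)
  have hc : A *ᵥ (exp ((-s) • A) *ᵥ x) = exp ((-s) • A) *ᵥ (A *ᵥ x) := by
    rw [mulVec_mulVec, mulVec_mulVec, (((Commute.refl A).smul_right (-s)).exp_right).eq]
  rw [hc, neg_one_smul] at h
  exact h

theorem gramian_lyapunov_le (γ h : ℝ) (x : ι → ℝ) :
    2 * (x ⬝ᵥ gramian A C γ h *ᵥ (A *ᵥ x)) + 2 * γ * (x ⬝ᵥ gramian A C γ h *ᵥ x) ≤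
      (C *ᵥ x) ⬝ᵥ (C *ᵥ x) := by
  let q : ℝ → ℝ := fun s => Real.exp (-(2 * γ) * s) *
    ((C *ᵥ (exp ((-s) • A) *ᵥ x)) ⬝ᵥ (C *ᵥ (exp ((-s) • A) *ᵥ x)))
  let r : ℝ → ℝ := fun s => Real.exp (-(2 * γ) * s) *
    ((C *ᵥ (exp ((-s) • A) *ᵥ x)) ⬝ᵥ (C *ᵥ (exp ((-s) • A) *ᵥ (A *ᵥ x))))
  have hq : ∀ s, HasDerivAt q (-(2 * γ) * q s + -2 * r s) s := fun s => by
    have h1 := (hasDerivAt_exp_neg_smul_mulVec A x s).matrix_mulVec C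
    have h2 := ((hasDerivAt_id s).const_mul (-(2 * γ))).exp.mul (h1.dotProduct_real h1)
    refine h2.congr_deriv ?_
    simp only [q, r, mulVec_neg, neg_dotProduct, dotProduct_neg, id]
    rw [dotProduct_comm (C *ᵥ (exp ((-s) • A) *ᵥ (A *ᵥ x)))]
    ring
  have hqc : Continuous q := continuous_gramian_form A C γ x x
  have hrc : Continuous r := continuous_gramian_form A C γ x (A *ᵥ x)
  have hint := intervalIntegral.integral_eq_sub_of_hasDerivAt (a := 0) (b := h)
    (fun s _ => hq s) (Continuous.intervalIntegrable (by fun_prop) _ _)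
  rw [intervalIntegral.integral_add ((hqc.const_mul _).intervalIntegrable _ _)
    ((hrc.const_mul _).intervalIntegrable _ _), intervalIntegral.integral_const_mul,
    intervalIntegral.integral_const_mul] at hint
  have hq0 : q 0 = (C *ᵥ x) ⬝ᵥ (C *ᵥ x) := by simp [q]
  have hqh : 0 ≤ q h := mul_nonneg (Real.exp_nonneg _) (dotProduct_self_nonneg_real _)
  rw [dotProduct_gramian_mulVec, dotProduct_gramian_mulVec]
  change 2 * (∫ s in (0 : ℝ)..h, r s) + 2 * γ * (∫ s in (0 : ℝ)..h, q s) ≤ _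
  linarith

variable {A C}

theorem dotProduct_gramian_zero_pos (hobs : ∀ x, (∀ k : ℕ, C *ᵥ (A ^ k *ᵥ x) = 0) → x = 0)
    {h : ℝ} (hh : 0 < h) {x : ι → ℝ} (hx : x ≠ 0) : 0 < x ⬝ᵥ gramian A C 0 h *ᵥ x := by
  rw [dotProduct_gramian_mulVec]
  have hnn : ∀ s : ℝ, 0 ≤ Real.exp (-(2 * 0) * s) *
      ((C *ᵥ (exp ((-s) • A) *ᵥ x)) ⬝ᵥ (C *ᵥ (exp ((-s) • A) *ᵥ x))) := fun s =>
    mul_nonneg (Real.exp_nonneg _) (dotProduct_self_nonneg_real _)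
  by_contra hcon
  have hzero : ∀ s ∈ Set.Ioo 0 h, C *ᵥ (exp ((-s) • A) *ᵥ x) = 0 := by
    intro s hs
    by_contra hne
    refine hcon (intervalIntegral.integral_pos hh
      (continuous_gramian_form A C 0 x x).continuousOn (fun s _ => hnn s)
      ⟨s, Set.Ioo_subset_Icc_self hs, mul_pos (Real.exp_pos _) ?_⟩)
    exact (dotProduct_self_nonneg_real _).lt_of_ne' (mt dotProduct_self_eq_zero.1 hne)
  have hall : ∀ k : ℕ, ∀ s ∈ Set.Ioo 0 h, C *ᵥ (exp ((-s) • A) *ᵥ (A ^ k *ᵥ x)) = 0 := by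
    intro k
    induction k with
    | zero => simpa using hzero
    | succ k ih =>
      intro s hs
      have h1 := (hasDerivAt_exp_neg_smul_mulVec A (A ^ k *ᵥ x) s).matrix_mulVec C
      have h2 : HasDerivAt (fun s : ℝ => C *ᵥ (exp ((-s) • A) *ᵥ (A ^ k *ᵥ x))) 0 s :=
        (hasDerivAt_const s (0 : κ → ℝ)).congr_of_eventuallyEq
          (Filter.eventually_of_mem (Ioo_mem_nhds hs.1 hs.2) ih)
      have h3 := h1.unique h2
      rw [mulVec_neg, neg_eq_zero, mulVec_mulVec x A, ← pow_succ'] at h3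
      exact h3
  apply hx
  have hmem : h / 2 ∈ Set.Ioo 0 h := ⟨by linarith, by linarith⟩
  have h0 : exp ((-(h / 2)) • A) *ᵥ x = 0 := by
    refine hobs _ fun k => ?_
    rw [mulVec_mulVec x (A ^ k),
      ((((Commute.refl A).smul_right (-(h / 2))).pow_left k).exp_right).eq, ← mulVec_mulVec]
    exact hall k _ hmem
  have h1 := exp_add_smul_mulVec A (h / 2) (-(h / 2)) x
  rw [h0, add_neg_cancel, zero_smul, exp_zero, one_mulVec, mulVec_zero] at h1
  exact h1

theorem exists_gramian_bounds (hobs : ∀ x, (∀ k : ℕ, C *ᵥ (A ^ k *ᵥ x) = 0) → x = 0)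
    {h : ℝ} (hh : 0 < h) : ∃ g > 0, ∃ K > 0, ∀ γ, 0 ≤ γ → ∀ x : ι → ℝ,
      g * Real.exp (-(2 * γ) * h) * (x ⬝ᵥ x) ≤ x ⬝ᵥ gramian A C γ h *ᵥ x ∧
      x ⬝ᵥ gramian A C γ h *ᵥ x ≤ K * (x ⬝ᵥ x) := by
  obtain ⟨g, hg, hgle⟩ := exists_pos_mul_le_dotProduct_mulVec (gramian A C 0 h) ⊤
    fun x _ hx => dotProduct_gramian_zero_pos hobs hh hx
  refine ⟨g, hg, opNorm (gramian A C 0 h) + 1, by have := opNorm_nonneg (gramian A C 0 h); linarith,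
    fun γ hγ x => ⟨?_, ?_⟩⟩
  · have h1 := mul_le_mul_of_nonneg_left (hgle x trivial) (Real.exp_nonneg (-(2 * γ) * h))
    calc _ = Real.exp (-(2 * γ) * h) * (g * (x ⬝ᵥ x)) := by ring
      _ ≤ _ := h1
      _ ≤ _ := by
        rw [dotProduct_gramian_mulVec, dotProduct_gramian_mulVec,
          ← intervalIntegral.integral_const_mul]
        refine intervalIntegral.integral_mono_on hh.le
          ((continuous_gramian_form A C 0 x x).const_mul _ |>.intervalIntegrable _ _)
          ((continuous_gramian_form A C γ x x).intervalIntegrable _ _) fun s hs => ?_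
        rw [← mul_assoc, ← Real.exp_add]
        refine mul_le_mul_of_nonneg_right (Real.exp_le_exp.2 ?_) (dotProduct_self_nonneg_real _)
        nlinarith [hs.2]
  · refine le_trans ?_ ((dotProduct_mulVec_le (gramian A C 0 h) x).trans
      (mul_le_mul_of_nonneg_right (by linarith) (dotProduct_self_nonneg_real x)))
    rw [dotProduct_gramian_mulVec, dotProduct_gramian_mulVec]
    refine intervalIntegral.integral_mono_on hh.le
      ((continuous_gramian_form A C γ x x).intervalIntegrable _ _)
      ((continuous_gramian_form A C 0 x x).intervalIntegrable _ _) fun s hs => ?_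
    refine mul_le_mul_of_nonneg_right (Real.exp_le_exp.2 ?_) (dotProduct_self_nonneg_real _)
    nlinarith [hs.1]

end Gramian

theorem eq_zero_of_obsvMatrix_rank {n m : ℕ} {A : Matrix (Fin n) (Fin n) ℝ}
    {C : Matrix (Fin m) (Fin n) ℝ} (hobsv : (obsvMatrix A C).rank = n) (x : Fin n → ℝ)
    (hx : ∀ k : ℕ, C *ᵥ (A ^ k *ᵥ x) = 0) : x = 0 := by
  have hker : (obsvMatrix A C)ᵀ *ᵥ x = 0 := by
    ext p
    have h := congrFun (hx p.1) p.2
    rw [mulVec_mulVec] at h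
    have : ∀ l, (obsvMatrix A C)ᵀ p l = (C * A ^ (p.1 : ℕ)) p.2 l := fun l => by
      rw [transpose_apply, obsvMatrix, of_apply, ← transpose_pow, ← transpose_mul, transpose_apply]
    simp only [mulVec, dotProduct, this]
    exact h
  have hr : Module.finrank ℝ (LinearMap.range (obsvMatrix A C)ᵀ.mulVecLin) = n := by
    exact (rank_transpose _).trans hobsv
  have hs := LinearMap.finrank_range_add_finrank_ker (obsvMatrix A C)ᵀ.mulVecLin
  rw [hr, Module.finrank_fin_fun] at hs
  have hbot := Submodule.finrank_eq_zero.1 (by omega : Module.finrank ℝ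
    (LinearMap.ker (obsvMatrix A C)ᵀ.mulVecLin) = 0)
  have : x ∈ LinearMap.ker (obsvMatrix A C)ᵀ.mulVecLin := hker
  rw [hbot] at this
  simpa using this

section Kronecker

variable {ν ι : Type*} [Fintype ν] [Fintype ι]

theorem one_kronecker_mulVec {κ : Type*} [DecidableEq ν] (B : Matrix κ ι ℝ)
    (v : ν × ι → ℝ) (i : ν) (k : κ) :
    (((1 : Matrix ν ν ℝ) ⊗ₖ B) *ᵥ v) (i, k) = (B *ᵥ fun l => v (i, l)) k := by
  simp [mulVec, dotProduct, Fintype.sum_prod_type, kroneckerMap_apply, one_apply, ite_mul]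

theorem kronecker_one_mulVec [DecidableEq ι] (Q : Matrix ν ν ℝ) (v : ν × ι → ℝ) (i : ν) (k : ι) :
    ((Q ⊗ₖ (1 : Matrix ι ι ℝ)) *ᵥ v) (i, k) = (Q *ᵥ fun j => v (j, k)) i := by
  simp [mulVec, dotProduct, Fintype.sum_prod_type, kroneckerMap_apply, one_apply, ite_mul, mul_ite]

theorem dotProduct_eq_sum_left (v w : ν × ι → ℝ) :
    v ⬝ᵥ w = ∑ i, (fun l => v (i, l)) ⬝ᵥ fun l => w (i, l) := by
  simp [dotProduct, Fintype.sum_prod_type]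

theorem dotProduct_eq_sum_right (v w : ν × ι → ℝ) :
    v ⬝ᵥ w = ∑ l, (fun i => v (i, l)) ⬝ᵥ fun i => w (i, l) := by
  simp [dotProduct, Fintype.sum_prod_type_right]

theorem dotProduct_one_kronecker_mulVec [DecidableEq ν] (B : Matrix ι ι ℝ) (v : ν × ι → ℝ) :
    v ⬝ᵥ ((1 : Matrix ν ν ℝ) ⊗ₖ B) *ᵥ v =
      ∑ i, (fun l => v (i, l)) ⬝ᵥ B *ᵥ fun l => v (i, l) := by
  rw [dotProduct_eq_sum_left]
  simp only [one_kronecker_mulVec]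

theorem dotProduct_kronecker_one_mulVec [DecidableEq ι] (Q : Matrix ν ν ℝ) (v : ν × ι → ℝ) :
    v ⬝ᵥ (Q ⊗ₖ (1 : Matrix ι ι ℝ)) *ᵥ v =
      ∑ l, (fun i => v (i, l)) ⬝ᵥ Q *ᵥ fun i => v (i, l) := by
  rw [dotProduct_eq_sum_right]
  simp only [kronecker_one_mulVec]

theorem eNorm_kronecker_one_mulVec_le [DecidableEq ν] [DecidableEq ι] (Q : Matrix ν ν ℝ)
    (v : ν × ι → ℝ) : eNorm ((Q ⊗ₖ (1 : Matrix ι ι ℝ)) *ᵥ v) ≤ opNorm Q * eNorm v := by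
  refine eNorm_le_of_dotProduct_le (opNorm_nonneg Q) ?_
  rw [dotProduct_eq_sum_right, dotProduct_eq_sum_right v v, Finset.mul_sum]
  simp only [kronecker_one_mulVec]
  refine Finset.sum_le_sum fun l _ => ?_
  have h := pow_le_pow_left₀ (eNorm_nonneg _) (eNorm_mulVec_le Q fun i => v (i, l)) 2
  rw [mul_pow, eNorm_sq, eNorm_sq] at h
  exact h

theorem commute_kronecker_one [DecidableEq ν] [DecidableEq ι] (Q : Matrix ν ν ℝ)
    (B : Matrix ι ι ℝ) :
    Commute (Q ⊗ₖ (1 : Matrix ι ι ℝ)) ((1 : Matrix ν ν ℝ) ⊗ₖ B) := by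
  rw [Commute, SemiconjBy, ← mul_kronecker_mul, ← mul_kronecker_mul]
  simp

/-- The vectors orthogonal to the kernel of `H`. -/
def kerOrthogonal (H : Matrix ν ν ℝ) : Submodule ℝ (ν → ℝ) where
  carrier := {y | ∀ z, H *ᵥ z = 0 → z ⬝ᵥ y = 0}
  zero_mem' := fun z _ => dotProduct_zero z
  add_mem' := fun ha hb z hz => by rw [dotProduct_add, ha z hz, hb z hz, add_zero]
  smul_mem' := fun c a ha z hz => by rw [dotProduct_smul, ha z hz, smul_zero]

theorem exists_coercive_kerOrthogonal {H : Matrix ν ν ℝ} (hH : H.PosSemidef) :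
    ∃ c > 0, ∀ y ∈ kerOrthogonal H, c * (y ⬝ᵥ y) ≤ y ⬝ᵥ H *ᵥ y := by
  refine exists_pos_mul_le_dotProduct_mulVec H _ fun y hy hy0 => ?_
  have h1 : 0 ≤ y ⬝ᵥ H *ᵥ y := by simpa using hH.dotProduct_mulVec_nonneg y
  refine h1.lt_of_ne' fun h => hy0 ?_
  have h2 : H *ᵥ y = 0 := (hH.dotProduct_mulVec_zero_iff y).1 (by simpa using h)
  exact dotProduct_self_eq_zero.1 (hy y h2)

/-- Coercivity of the coupling `H ⊗ CᵀC` on the range of the complementary projection. -/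
theorem sum_output_le_coupling {κ : Type*} [Fintype κ] [DecidableEq ν] [DecidableEq ι]
    [DecidableEq κ]
    {H P : Matrix ν ν ℝ} {c : ℝ}
    (hc : ∀ y ∈ kerOrthogonal H, c * (y ⬝ᵥ y) ≤ y ⬝ᵥ H *ᵥ y) (hPs : Pᵀ = P)
    (hPfix : ∀ x, H *ᵥ x = 0 → P *ᵥ x = x) (C : Matrix κ ι ℝ) {v : ν × ι → ℝ}
    (hv : (P ⊗ₖ (1 : Matrix ι ι ℝ)) *ᵥ v = 0) :
    c * ∑ i, (C *ᵥ fun l => v (i, l)) ⬝ᵥ (C *ᵥ fun l => v (i, l)) ≤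
      v ⬝ᵥ (H ⊗ₖ (Cᵀ * C)) *ᵥ v := by
  let w : ν × κ → ℝ := ((1 : Matrix ν ν ℝ) ⊗ₖ C) *ᵥ v
  have hw : ∀ i, (fun k => w (i, k)) = C *ᵥ fun l => v (i, l) := fun i => by
    ext k; exact one_kronecker_mulVec C v i k
  have hPw : (P ⊗ₖ (1 : Matrix κ κ ℝ)) *ᵥ w = 0 := by
    have : (P ⊗ₖ (1 : Matrix κ κ ℝ)) * ((1 : Matrix ν ν ℝ) ⊗ₖ C) =
        ((1 : Matrix ν ν ℝ) ⊗ₖ C) * (P ⊗ₖ (1 : Matrix ι ι ℝ)) := by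
      rw [← mul_kronecker_mul, ← mul_kronecker_mul]; simp
    rw [mulVec_mulVec, this, ← mulVec_mulVec, hv, mulVec_zero]
  have hfac : H ⊗ₖ (Cᵀ * C) = ((1 : Matrix ν ν ℝ) ⊗ₖ C)ᵀ *
      ((H ⊗ₖ (1 : Matrix κ κ ℝ)) * ((1 : Matrix ν ν ℝ) ⊗ₖ C)) := by
    rw [← kroneckerMap_transpose, ← mul_kronecker_mul, ← mul_kronecker_mul]; simp
  have hform : v ⬝ᵥ (H ⊗ₖ (Cᵀ * C)) *ᵥ v = w ⬝ᵥ (H ⊗ₖ (1 : Matrix κ κ ℝ)) *ᵥ w := by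
    rw [hfac, ← mulVec_mulVec, dotProduct_mulVec, vecMul_transpose, mulVec_mulVec]
  have hsum : ∑ i, (C *ᵥ fun l => v (i, l)) ⬝ᵥ (C *ᵥ fun l => v (i, l)) = w ⬝ᵥ w := by
    rw [dotProduct_eq_sum_left]; simp only [hw]
  rw [hform, hsum, dotProduct_kronecker_one_mulVec, dotProduct_eq_sum_right, Finset.mul_sum]
  refine Finset.sum_le_sum fun k _ => hc _ fun z hz => ?_
  have hk : P *ᵥ (fun i => w (i, k)) = 0 := by
    ext i
    rw [← kronecker_one_mulVec, hPw]
    rfl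
  rw [← hPfix z hz, dotProduct_comm, dotProduct_mulVec, ← mulVec_transpose, hPs, hk,
    zero_dotProduct]

theorem exists_mulVec_eq_smul_of_one_kronecker [DecidableEq ν] {A : Matrix ι ι ℝ} {μ : ℂ}
    (h : ∃ v : ν × ι → ℂ, v ≠ 0 ∧ (((1 : Matrix ν ν ℝ) ⊗ₖ A).map Complex.ofReal) *ᵥ v = μ • v) :
    ∃ v : ι → ℂ, v ≠ 0 ∧ (A.map Complex.ofReal) *ᵥ v = μ • v := by
  obtain ⟨v, hv, hμ⟩ := h
  obtain ⟨⟨i, k⟩, hik⟩ := Function.ne_iff.1 hv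
  refine ⟨fun l => v (i, l), fun h0 => hik (congrFun h0 k), ?_⟩
  ext l
  have := congrFun hμ (i, l)
  simp only [mulVec, dotProduct, Fintype.sum_prod_type, kroneckerMap_apply, one_apply, map_apply,
    ite_mul, one_mul, zero_mul, Complex.ofReal_zero, apply_ite Complex.ofReal] at this
  simpa [mulVec, dotProduct] using this

end Kronecker

section SingleStep

variable {ν ι κ : Type*} [Fintype ν] [Fintype ι] [Fintype κ] [DecidableEq ν] [DecidableEq ι]
  [DecidableEq κ]

/-- Energy decay for the error component orthogonal to the kernel of the coupling matrix. -/
theorem energy_le_of_kronecker_one_mulVec_eq_zero {H P : Matrix ν ν ℝ} {A W : Matrix ι ι ℝ}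
    {C : Matrix κ ι ℝ} {L : Matrix ι κ ℝ} {c γ a b : ℝ} (hc0 : 0 < c)
    (hc : ∀ y ∈ kerOrthogonal H, c * (y ⬝ᵥ y) ≤ y ⬝ᵥ H *ᵥ y) (hPs : Pᵀ = P)
    (hPfix : ∀ x, H *ᵥ x = 0 → P *ᵥ x = x) (hWs : Wᵀ = W)
    (hWA : ∀ x, 2 * (x ⬝ᵥ W *ᵥ (A *ᵥ x)) + 2 * γ * (x ⬝ᵥ W *ᵥ x) ≤ (C *ᵥ x) ⬝ᵥ (C *ᵥ x))
    (hWL : W * L = (1 / (2 * c)) • Cᵀ) (hab : a ≤ b) {z : ℝ → ν × ι → ℝ}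
    (hcont : ContinuousOn z (Set.Icc a b))
    (hz : ∀ t ∈ Set.Ioo a b,
      HasDerivAt z (((1 : Matrix ν ν ℝ) ⊗ₖ A - H ⊗ₖ (L * C)) *ᵥ z t) t)
    (hPz : ∀ t ∈ Set.Ioo a b, (P ⊗ₖ (1 : Matrix ι ι ℝ)) *ᵥ z t = 0) :
    z b ⬝ᵥ ((1 : Matrix ν ν ℝ) ⊗ₖ W) *ᵥ z b ≤
      Real.exp (-(2 * γ) * (b - a)) * (z a ⬝ᵥ ((1 : Matrix ν ν ℝ) ⊗ₖ W) *ᵥ z a) := by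
  refine dotProduct_mulVec_le_exp_mul hab hcont hz fun t ht => ?_
  have hsymm : ((1 : Matrix ν ν ℝ) ⊗ₖ W)ᵀ = (1 : Matrix ν ν ℝ) ⊗ₖ W := by
    rw [← kroneckerMap_transpose, transpose_one, hWs]
  have hWB : ((1 : Matrix ν ν ℝ) ⊗ₖ W) * ((1 : Matrix ν ν ℝ) ⊗ₖ A - H ⊗ₖ (L * C)) =
      (1 : Matrix ν ν ℝ) ⊗ₖ (W * A) - (1 / (2 * c)) • H ⊗ₖ (Cᵀ * C) := by
    rw [mul_sub, ← mul_kronecker_mul, ← mul_kronecker_mul, one_mul, one_mul,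
      ← Matrix.mul_assoc W L C, hWL, Matrix.smul_mul, kronecker_smul]
  generalize ((1 : Matrix ν ν ℝ) ⊗ₖ A - H ⊗ₖ (L * C)) = B at hWB ⊢
  generalize hv : z t = v
  have hcomm : (B *ᵥ v) ⬝ᵥ ((1 : Matrix ν ν ℝ) ⊗ₖ W) *ᵥ v =
      v ⬝ᵥ ((1 : Matrix ν ν ℝ) ⊗ₖ W) *ᵥ (B *ᵥ v) := by
    rw [dotProduct_mulVec, ← mulVec_transpose, hsymm, dotProduct_comm]
  have hout := sum_output_le_coupling hc hPs hPfix C (hv ▸ hPz t ht)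
  have hlyap := Finset.sum_le_sum fun i (_ : i ∈ Finset.univ) => hWA fun l => v (i, l)
  simp only [mulVec_mulVec _ W A] at hlyap
  rw [Finset.sum_add_distrib, ← Finset.mul_sum, ← Finset.mul_sum,
    ← dotProduct_one_kronecker_mulVec W, ← dotProduct_one_kronecker_mulVec (W * A)] at hlyap
  rw [hcomm, mulVec_mulVec, hWB, sub_mulVec, dotProduct_sub, smul_mulVec, dotProduct_smul,
    smul_eq_mul]
  have hdiv := (le_div_iff₀' hc0).2 hout
  have hhalf : 2 * (1 / (2 * c) * (v ⬝ᵥ (H ⊗ₖ (Cᵀ * C)) *ᵥ v)) =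
      v ⬝ᵥ (H ⊗ₖ (Cᵀ * C)) *ᵥ v / c := by field_simp
  linarith

/-- A gain making one dwell interval act, up to a small error, as the projection onto the kernel
of the coupling matrix followed by the free flow. -/
theorem exists_gain {A : Matrix ι ι ℝ} {C : Matrix κ ι ℝ}
    (hobs : ∀ x, (∀ k : ℕ, C *ᵥ (A ^ k *ᵥ x) = 0) → x = 0) {τ c ε : ℝ} (hτ : 0 < τ) (hc0 : 0 < c)
    (hε : 0 < ε) :
    ∃ L : Matrix ι κ ℝ, ∀ H P : Matrix ν ν ℝ,
      (∀ y ∈ kerOrthogonal H, c * (y ⬝ᵥ y) ≤ y ⬝ᵥ H *ᵥ y) → Hᵀ = H → Pᵀ = P → P * P = P →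
      H * P = 0 → (∀ x, H *ᵥ x = 0 → P *ᵥ x = x) →
      ∀ (a b : ℝ) (η : ℝ → ν × ι → ℝ), a + τ ≤ b → ContinuousOn η (Set.Icc a b) →
        (∀ t ∈ Set.Ioo a b,
          HasDerivAt η (((1 : Matrix ν ν ℝ) ⊗ₖ A - H ⊗ₖ (L * C)) *ᵥ η t) t) →
        ∃ e, η b = exp ((b - a) • ((1 : Matrix ν ν ℝ) ⊗ₖ A)) *ᵥ
            ((P ⊗ₖ (1 : Matrix ι ι ℝ)) *ᵥ η a) + e ∧ eNorm e ≤ ε * eNorm (η a) := by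
  obtain ⟨g, hg, K, hK, hbd⟩ := exists_gramian_bounds hobs (half_pos hτ)
  obtain ⟨γ, hγ, hγε⟩ : ∃ γ, 0 ≤ γ ∧ K / g * Real.exp (-(γ * τ)) ≤ ε ^ 2 := by
    have h1 : Filter.Tendsto (fun γ : ℝ => K / g * Real.exp (-(γ * τ))) Filter.atTop
        (nhds (K / g * 0)) :=
      (Real.tendsto_exp_neg_atTop_nhds_zero.comp
        (Filter.tendsto_id.atTop_mul_const hτ)).const_mul _
    rw [mul_zero] at h1
    have h2 := h1.eventually (gt_mem_nhds (pow_pos hε 2))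
    obtain ⟨γ, hγ, h⟩ := ((Filter.eventually_ge_atTop 0).and h2).exists
    exact ⟨γ, hγ, h.le⟩
  set W := gramian A C γ (τ / 2) with hW
  have hlow : 0 < g * Real.exp (-(2 * γ) * (τ / 2)) := by positivity
  have hdet : IsUnit W := by
    refine mulVec_injective_iff_isUnit.1 ((injective_iff_map_eq_zero W.mulVecLin).2 fun x hx => ?_)
    have h := (hbd γ hγ x).1
    rw [mulVecLin_apply] at hx
    rw [← hW, hx, dotProduct_zero] at h
    exact dotProduct_self_eq_zero.1
      (le_antisymm (nonpos_of_mul_nonpos_right h hlow) (dotProduct_self_nonneg_real x))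
  refine ⟨W⁻¹ * ((1 / (2 * c)) • Cᵀ), fun H P hc hHs hPs hPi hHP hPfix a b η hab hcont hη => ?_⟩
  have hWL : W * (W⁻¹ * ((1 / (2 * c)) • Cᵀ)) = (1 / (2 * c)) • Cᵀ :=
    mul_nonsing_inv_cancel_left _ _ ((isUnit_iff_isUnit_det W).1 hdet)
  generalize W⁻¹ * ((1 / (2 * c)) • Cᵀ) = L at hWL hη
  have hPH : P * H = 0 := by
    rw [← transpose_transpose (P * H), transpose_mul, hHs, hPs, hHP, transpose_zero]
  set Q : Matrix (ν × ι) (ν × ι) ℝ := P ⊗ₖ (1 : Matrix ι ι ℝ) with hQ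
  set F : Matrix (ν × ι) (ν × ι) ℝ := (1 : Matrix ν ν ℝ) ⊗ₖ A with hF
  have hQs : Qᵀ = Q := by rw [hQ, ← kroneckerMap_transpose, hPs, transpose_one]
  have hQi : Q * Q = Q := by rw [hQ, ← mul_kronecker_mul, hPi, one_mul]
  have hQB : Q * (F - H ⊗ₖ (L * C)) = F * Q := by
    rw [mul_sub, hQ, hF, ← mul_kronecker_mul, ← mul_kronecker_mul, ← mul_kronecker_mul, hPH]
    simp
  have hBQ : (F - H ⊗ₖ (L * C)) * Q = F * Q := by
    rw [sub_mul, hQ, ← mul_kronecker_mul (A := H), hHP]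
    simp
  have hab' : a ≤ b := by linarith
  have hQcont : ContinuousOn (fun t => Q *ᵥ η t) (Set.Icc a b) :=
    Q.mulVecLin.continuous_of_finiteDimensional.comp_continuousOn hcont
  have hy : Q *ᵥ η b = exp ((b - a) • F) *ᵥ (Q *ᵥ η a) := by
    refine eq_exp_smul_mulVec_of_hasDerivAt (y := fun t => Q *ᵥ η t) hab' hQcont fun t ht => ?_
    have h := (hη t ht).matrix_mulVec Q
    rw [mulVec_mulVec, hQB, ← mulVec_mulVec] at h
    exact h
  have henergy := energy_le_of_kronecker_one_mulVec_eq_zero (z := fun t => η t - Q *ᵥ η t) hc0 hc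
    hPs hPfix (transpose_gramian A C γ (τ / 2)) (gramian_lyapunov_le A C γ (τ / 2)) hWL hab'
    (hcont.sub hQcont) (fun t ht => by
      have h := (hη t ht).sub ((hη t ht).matrix_mulVec Q)
      rw [mulVec_mulVec, hQB, ← hBQ, ← mulVec_mulVec, ← mulVec_sub] at h
      exact h) (fun t _ => by rw [mulVec_sub, mulVec_mulVec, hQi, sub_self])
  have hkron : ∀ v : ν × ι → ℝ, g * Real.exp (-(2 * γ) * (τ / 2)) * (v ⬝ᵥ v) ≤
      v ⬝ᵥ ((1 : Matrix ν ν ℝ) ⊗ₖ W) *ᵥ v ∧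
      v ⬝ᵥ ((1 : Matrix ν ν ℝ) ⊗ₖ W) *ᵥ v ≤ K * (v ⬝ᵥ v) := fun v => by
    rw [dotProduct_one_kronecker_mulVec, dotProduct_eq_sum_left, Finset.mul_sum, Finset.mul_sum]
    exact ⟨Finset.sum_le_sum fun i _ => (hbd γ hγ _).1,
      Finset.sum_le_sum fun i _ => (hbd γ hγ _).2⟩
  refine ⟨η b - Q *ᵥ η b, by rw [← hy, add_sub_cancel], eNorm_le_of_dotProduct_le hε.le ?_⟩
  have hcontr : (η a - Q *ᵥ η a) ⬝ᵥ (η a - Q *ᵥ η a) ≤ η a ⬝ᵥ η a := by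
    have h := eNorm_mulVec_le_of_isSymm_of_idem (Q := 1 - Q)
      (by rw [transpose_sub, transpose_one, hQs])
      (by rw [sub_mul, one_mul, mul_sub, mul_one, hQi, sub_self, sub_zero]) (η a)
    rw [sub_mulVec, one_mulVec] at h
    have h' := pow_le_pow_left₀ (eNorm_nonneg _) h 2
    rwa [eNorm_sq, eNorm_sq] at h'
  have h0 := dotProduct_self_nonneg_real (η a)
  have h1 := (hkron (η b - Q *ᵥ η b)).1
  have h2 := (hkron (η a - Q *ᵥ η a)).2
  have h3 : Real.exp (-(2 * γ) * (b - a)) ≤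
      Real.exp (-(2 * γ) * (τ / 2)) * Real.exp (-(γ * τ)) := by
    rw [← Real.exp_add, Real.exp_le_exp]
    nlinarith
  have h4 : Real.exp (-(2 * γ) * (b - a)) * (K * (η a ⬝ᵥ η a)) ≤
      g * Real.exp (-(2 * γ) * (τ / 2)) * (ε ^ 2 * (η a ⬝ᵥ η a)) := by
    calc _ ≤ (Real.exp (-(2 * γ) * (τ / 2)) * Real.exp (-(γ * τ))) * (K * (η a ⬝ᵥ η a)) := by
          gcongr
      _ = g * Real.exp (-(2 * γ) * (τ / 2)) *
          ((K / g * Real.exp (-(γ * τ))) * (η a ⬝ᵥ η a)) := by field_simp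
      _ ≤ _ := by gcongr
  refine le_of_mul_le_mul_left ?_ hlow
  refine h1.trans (henergy.trans (le_trans ?_ h4))
  gcongr
  exact h2.trans (by gcongr)

end SingleStep

section Switching

theorem descProd_self {R : Type*} [Monoid R] (f : ℕ → R) (a : ℕ) : descProd f a a = 1 := by
  simp [descProd]

theorem descProd_succ {R : Type*} [Monoid R] (f : ℕ → R) (a d : ℕ) :
    descProd f a (a + (d + 1)) = f (a + d) * descProd f a (a + d) := by
  simp only [descProd, Nat.add_sub_cancel_left, List.range_succ_eq_map, List.map_cons,
    List.prod_cons, List.map_map]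
  congr 1
  refine congrArg List.prod (List.map_congr_left fun i _ => ?_)
  simp only [Function.comp_apply]
  congr 1
  omega

theorem descProd_kronecker_one {ν ι : Type*} [Fintype ν] [Fintype ι] [DecidableEq ν]
    [DecidableEq ι] (P : ℕ → Matrix ν ν ℝ) (a d : ℕ) :
    descProd (fun r => P r ⊗ₖ (1 : Matrix ι ι ℝ)) a (a + d) =
      descProd P a (a + d) ⊗ₖ (1 : Matrix ι ι ℝ) := by
  induction d with
  | zero => simp [descProd_self]
  | succ d ih => rw [descProd_succ, descProd_succ, ih, ← mul_kronecker_mul, one_mul]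

theorem mul_natCast_le_of_le_sub {u : ℕ → ℝ} {τ : ℝ} (hu : ∀ r, τ ≤ u (r + 1) - u r) (a d : ℕ) :
    d * τ ≤ u (a + d) - u a := by
  induction d with
  | zero => simp
  | succ d ih => have := hu (a + d); push_cast; rw [← add_assoc]; linarith

theorem exists_mem_Ico_of_le_sub {u : ℕ → ℝ} {τ : ℝ} (hτ : 0 < τ) (hu0 : u 0 = 0)
    (hu : ∀ r, τ ≤ u (r + 1) - u r) {t : ℝ} (ht : 0 ≤ t) : ∃ k, t ∈ Set.Ico (u k) (u (k + 1)) := by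
  have hex : ∃ k, t < u k := by
    obtain ⟨k, hk⟩ := exists_nat_gt (t / τ)
    have h := mul_natCast_le_of_le_sub hu 0 k
    rw [zero_add, hu0, sub_zero] at h
    exact ⟨k, ((div_lt_iff₀ hτ).1 hk).trans_le h⟩
  classical
  obtain ⟨k, hk⟩ := Nat.exists_eq_succ_of_ne_zero (n := Nat.find hex) fun h0 => by
    have := Nat.find_spec hex
    rw [h0, hu0] at this
    linarith
  refine ⟨k, not_lt.1 (Nat.find_min hex (by omega)), ?_⟩
  have := Nat.find_spec hex
  rwa [hk] at this

/-- The state after `d` perturbed steps, compared with the unperturbed free flow composed with the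
product of the projections. -/
theorem exists_eq_exp_descProd_add {ι : Type*} [Fintype ι] [DecidableEq ι] {f : (ι → ℝ) → ℝ}
    {F : Matrix ι ι ℝ} {Q : ℕ → Matrix ι ι ℝ} {α ε T : ℝ} {x : ℕ → ι → ℝ} {u : ℕ → ℝ}
    (hf0 : ∀ x, 0 ≤ f x) (hfz : f 0 ≤ 0) (hfadd : ∀ x y, f (x + y) ≤ f x + f y) (hα : 0 ≤ α)
    (hexp : ∀ s, 0 ≤ s → ∀ x, f (exp (s • F) *ᵥ x) ≤ Real.exp (α * s) * f x)
    (hQ : ∀ r x, f (Q r *ᵥ x) ≤ f x) (hcomm : ∀ r, Commute (Q r) F) (hε0 : 0 ≤ ε) (hε1 : ε ≤ 1)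
    (hu : Monotone u)
    (hx : ∀ r, ∃ e, x (r + 1) = exp ((u (r + 1) - u r) • F) *ᵥ (Q r *ᵥ x r) + e ∧
      f e ≤ ε * f (x r)) (a d : ℕ) (hd : u (a + d) - u a ≤ T) :
    f (x (a + d)) ≤ (Real.exp (α * T) + 1) ^ d * f (x a) ∧
      ∃ e, x (a + d) = exp ((u (a + d) - u a) • F) *ᵥ (descProd Q a (a + d) *ᵥ x a) + e ∧
        f e ≤ ε * (d * (Real.exp (α * T) + 1) ^ d) * f (x a) := by
  induction d with
  | zero =>
    exact ⟨by simp, 0, by simp [descProd_self], by simpa using hfz⟩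
  | succ d ih =>
    have hle : u (a + d) ≤ u (a + (d + 1)) := hu (by omega)
    have hle' : u a ≤ u (a + d) := hu (by omega)
    obtain ⟨hgrow, e, he, hfe⟩ := ih (by linarith)
    obtain ⟨e', he', hfe'⟩ := hx (a + d)
    rw [← add_assoc] at hd hle ⊢
    have hstep : ∀ y, f (exp ((u (a + d + 1) - u (a + d)) • F) *ᵥ (Q (a + d) *ᵥ y)) ≤
        Real.exp (α * T) * f y := fun y => by
      refine (hexp _ (by linarith) _).trans ?_
      gcongr
      · exact hf0 _
      · linarith
      · exact hQ _ _
    set M := Real.exp (α * T) with hM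
    have hM0 : 0 < M := Real.exp_pos _
    have hf := hf0 (x a)
    have hpow : 0 ≤ (M + 1) ^ d * f (x a) := by positivity
    refine ⟨?_, exp ((u (a + d + 1) - u (a + d)) • F) *ᵥ (Q (a + d) *ᵥ e) + e', ?_, ?_⟩
    · calc f (x (a + d + 1)) ≤ M * f (x (a + d)) + ε * f (x (a + d)) := by
            rw [he']; exact (hfadd _ _).trans (add_le_add (hstep _) hfe')
        _ ≤ (M + 1) * f (x (a + d)) := by nlinarith [hf0 (x (a + d))]
        _ ≤ (M + 1) * ((M + 1) ^ d * f (x a)) := by gcongr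
        _ = (M + 1) ^ (d + 1) * f (x a) := by ring
    · have hc : Q (a + d) * exp ((u (a + d) - u a) • F) =
          exp ((u (a + d) - u a) • F) * Q (a + d) :=
        (((hcomm (a + d)).smul_right (u (a + d) - u a)).exp_right).eq
      have hsum : u (a + d + 1) - u a = (u (a + d + 1) - u (a + d)) + (u (a + d) - u a) := by ring
      rw [he', he, mulVec_add, mulVec_add, mulVec_mulVec _ (Q (a + d)), hc, ← mulVec_mulVec,
        mulVec_mulVec _ (Q (a + d)), ← exp_add_smul_mulVec, ← hsum, add_assoc a d 1,
        descProd_succ, add_assoc]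
    · calc f (exp ((u (a + d + 1) - u (a + d)) • F) *ᵥ (Q (a + d) *ᵥ e) + e')
          ≤ M * (ε * (d * (M + 1) ^ d) * f (x a)) + ε * ((M + 1) ^ d * f (x a)) := by
            refine (hfadd _ _).trans (add_le_add ((hstep e).trans ?_) (hfe'.trans ?_)) <;> gcongr
        _ = ε * (M * d + 1) * ((M + 1) ^ d * f (x a)) := by ring
        _ ≤ ε * ((d + 1) * (M + 1)) * ((M + 1) ^ d * f (x a)) := by
            gcongr; nlinarith [(Nat.cast_nonneg d : (0 : ℝ) ≤ d)]
        _ = ε * ((d + 1 : ℕ) * (M + 1) ^ (d + 1)) * f (x a) := by push_cast; ring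

theorem exists_rate {ι : Type*} [Fintype ι] [DecidableEq ι] {M : Matrix ι ι ℂ} {β : ℝ}
    (hβ : 0 < β) (h : ∀ μ : ℂ, (∃ v : ι → ℂ, v ≠ 0 ∧ M *ᵥ v = μ • v) → μ.re < β) :
    ∃ α, 0 < α ∧ α < β ∧ ∀ μ : ℂ, (∃ v : ι → ℂ, v ≠ 0 ∧ M *ᵥ v = μ • v) → μ.re < α := by
  have hfin : {μ : ℂ | ∃ v : ι → ℂ, v ≠ 0 ∧ M *ᵥ v = μ • v}.Finite := by
    refine (Module.End.finite_hasEigenvalue M.toLin').subset ?_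
    rintro μ ⟨v, hv, hμ⟩
    exact Module.End.hasEigenvalue_of_hasEigenvector
      ⟨Module.End.mem_eigenspace_iff.2 (by rw [toLin'_apply, hμ]), hv⟩
  obtain ⟨ρ, hρ, hmax⟩ := Set.exists_max_image _ id ((hfin.image Complex.re).insert 0)
    (Set.insert_nonempty _ _)
  have hρβ : ρ < β := by
    rcases hρ with rfl | ⟨μ, hμ, rfl⟩
    · exact hβ
    · exact h μ hμ
  have hρ0 : 0 ≤ ρ := hmax 0 (Set.mem_insert _ _)
  refine ⟨(ρ + β) / 2, by linarith, by linarith, fun μ hμ => ?_⟩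
  have : μ.re ≤ ρ := hmax _ (Set.mem_insert_of_mem _ (Set.mem_image_of_mem _ hμ))
  linarith

theorem opNorm_le_of_eq_iSup {ν : Type*} [Fintype ν] [DecidableEq ν] {D : ℕ → Matrix ν ν ℝ}
    {δ : ℝ} (hδ0 : 0 < δ) (hδ : δ = ⨆ k, opNorm (D k)) (k : ℕ) : opNorm (D k) ≤ δ := by
  have hbdd : BddAbove (Set.range fun k => opNorm (D k)) := by
    by_contra h
    rw [Real.iSup_of_not_bddAbove h] at hδ
    exact hδ0.ne' hδ
  rw [hδ]
  exact le_ciSup hbdd k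

theorem pow_le_exp_of_le {θ T t : ℝ} {k : ℕ} (hθ0 : 0 < θ) (hθ1 : θ < 1) (hT : 0 < T)
    (ht : t ≤ (k + 1) * T) : θ ^ k ≤ θ⁻¹ * Real.exp (Real.log θ / T * t) := by
  have hlog : Real.log θ < 0 := Real.log_neg hθ0 hθ1
  have h : Real.log θ * (k + 1) ≤ Real.log θ / T * t := by
    rw [div_mul_eq_mul_div, le_div_iff₀ hT, mul_assoc]
    exact mul_le_mul_of_nonpos_left ht hlog.le
  have h' := Real.exp_le_exp.2 h
  rw [mul_comm, ← Nat.cast_succ, Real.exp_nat_mul, Real.exp_log hθ0] at h'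
  rw [inv_mul_eq_div, le_div_iff₀ hθ0, ← pow_succ]
  exact h'

end Switching

/-- exponentially convergent output-based distributed observer over jointly
connected switching networks: under the switching setup, observability of `(C,A)`, and
`Re(μ) < -(ln δ)/T_c` for every complex eigenvalue `μ` of `A`, there exist an observer
gain `L` and constants `C, ϱ > 0` such that every differentiable solution of the switched
estimation-error system `η̄' = (I_N ⊗ A - H_{σ(j)} ⊗ LC) η̄` satisfies
`‖η̄(t)‖ ≤ C e^{-ϱt} ‖η̄(0)‖`. -/
theorem distributed_observer_exponential_convergence
    (N n m nP : ℕ) (hN : 1 ≤ N) (hn : 1 ≤ n) (hm : 1 ≤ m)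
    (G : Fin nP → SimpleGraph (Fin N)) [∀ p, DecidableRel (G p).Adj]
    (Δ : Fin nP → (Fin N → ℝ)) (hΔ : ∀ p i, Δ p i = 0 ∨ Δ p i = 1)
    (Hmat : Fin nP → Matrix (Fin N) (Fin N) ℝ)
    (hHmat : ∀ p, Hmat p = (G p).lapMatrix ℝ + Matrix.diagonal (Δ p))
    (τ : ℝ) (hτ : 0 < τ)
    (ts : ℕ → ℝ) (hts0 : ts 0 = 0) (hdwell : ∀ r : ℕ, τ ≤ ts (r + 1) - ts r)
    (σ : ℕ → Fin nP)
    (j : ℕ → ℕ) (hj0 : j 0 = 0) (hjmono : StrictMono j)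
    (Tc : ℝ) (hTc : 0 < Tc) (hTcb : ∀ k : ℕ, ts (j (k + 1)) - ts (j k) ≤ Tc)
    (hjoint : ∀ k : ℕ, (∑ r ∈ Finset.Ico (j k) (j (k + 1)), Hmat (σ r)).PosDef)
    (Pproj : ℕ → Matrix (Fin N) (Fin N) ℝ)
    (hPsymm : ∀ r : ℕ, (Pproj r)ᵀ = Pproj r)
    (hPidem : ∀ r : ℕ, Pproj r * Pproj r = Pproj r)
    (hPrange : ∀ r : ℕ, ∀ x : Fin N → ℝ, (Hmat (σ r)).mulVec ((Pproj r).mulVec x) = 0)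
    (hPfix : ∀ r : ℕ, ∀ x : Fin N → ℝ,
      (Hmat (σ r)).mulVec x = 0 → (Pproj r).mulVec x = x)
    (δ : ℝ) (hδ : δ = ⨆ k : ℕ, opNorm (descProd Pproj (j k) (j (k + 1))))
    (hδ0 : 0 < δ) (hδ1 : δ < 1)
    (A : Matrix (Fin n) (Fin n) ℝ) (C : Matrix (Fin m) (Fin n) ℝ)
    (hobsv : (obsvMatrix A C).rank = n)
    (hspec : ∀ μ : ℂ,
      (∃ v : Fin n → ℂ, v ≠ 0 ∧ (A.map (Complex.ofReal)).mulVec v = μ • v) →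
        μ.re < -(Real.log δ) / Tc) :
    ∃ L : Matrix (Fin n) (Fin m) ℝ, ∃ Cconst ϱ : ℝ, 0 < Cconst ∧ 0 < ϱ ∧
      ∀ ηbar : ℝ → (Fin N × Fin n → ℝ),
        (∀ r : ℕ, ∀ s ∈ Set.Ico (ts r) (ts (r + 1)),
          HasDerivWithinAt ηbar
            ((((1 : Matrix (Fin N) (Fin N) ℝ) ⊗ₖ A -
                Hmat (σ r) ⊗ₖ (L * C))).mulVec (ηbar s))
            (Set.Ici (0 : ℝ)) s) →
        ∀ t : ℝ, 0 ≤ t →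
          eNorm (ηbar t) ≤ Cconst * Real.exp (-ϱ * t) * eNorm (ηbar 0) := by
  have hβ : 0 < -(Real.log δ) / Tc := div_pos (neg_pos.2 (Real.log_neg hδ0 hδ1)) hTc
  obtain ⟨α, hα0, hαβ, hα⟩ := exists_rate hβ hspec
  let F : Matrix (Fin N × Fin n) (Fin N × Fin n) ℝ := (1 : Matrix (Fin N) (Fin N) ℝ) ⊗ₖ A
  obtain ⟨M, hM1, hM⟩ := exists_opNorm_exp_smul_le F
    fun μ hμ => hα μ (exists_mulVec_eq_smul_of_one_kronecker hμ)
  obtain ⟨f, hf1, hf2, hfadd, hfexp, hfQ⟩ := exists_adapted_norm hM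
  have hf0 : ∀ x, 0 ≤ f x := fun x => (eNorm_nonneg x).trans (hf1 x)
  have hfz : f 0 ≤ 0 := by simpa [eNorm] using hf2 0
  set G₀ := Real.exp (α * Tc) with hG₀
  have hG0 : 0 < G₀ := Real.exp_pos _
  have hδG : δ * G₀ < 1 := by
    rw [lt_div_iff₀ hTc] at hαβ
    calc δ * G₀ = Real.exp (Real.log δ + α * Tc) := by rw [Real.exp_add, Real.exp_log hδ0]
      _ < 1 := by rw [Real.exp_lt_one_iff]; linarith
  set R := ⌈Tc / τ⌉₊ with hR
  set S : ℝ := R * (G₀ + 1) ^ R with hS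
  have hS0 : 0 ≤ S := by positivity
  set θ := (1 + δ * G₀) / 2 with hθ
  have hθ0 : 0 < θ := by positivity
  have hθ1 : θ < 1 := by rw [hθ]; linarith
  obtain ⟨ε, hε0, hε1, hεS⟩ : ∃ ε : ℝ, 0 < ε ∧ ε ≤ 1 ∧ ε * S ≤ (1 - δ * G₀) / 2 := by
    refine ⟨min 1 ((1 - δ * G₀) / 2 / (S + 1)),
      lt_min one_pos (div_pos (by linarith) (by linarith)), min_le_left _ _, ?_⟩
    calc _ ≤ (1 - δ * G₀) / 2 / (S + 1) * (S + 1) :=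
          mul_le_mul (min_le_right _ _) (by linarith) hS0
            (div_nonneg (by linarith) (by linarith))
      _ = (1 - δ * G₀) / 2 := div_mul_cancel₀ _ (by linarith)
  have hHsemi : ∀ p, (Hmat p).PosSemidef := fun p => by
    rw [hHmat p]
    refine (SimpleGraph.posSemidef_lapMatrix ℝ (G p)).add (PosSemidef.diagonal fun i => ?_)
    rcases hΔ p i with h | h <;> simp [h]
  have hHsymm : ∀ p, (Hmat p)ᵀ = Hmat p := fun p => by
    simpa using (hHsemi p).isHermitian.eq
  have : Nonempty (Fin nP) := ⟨σ 0⟩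
  obtain ⟨c, hc0, hc⟩ : ∃ c > 0, ∀ p, ∀ y ∈ kerOrthogonal (Hmat p),
      c * (y ⬝ᵥ y) ≤ y ⬝ᵥ Hmat p *ᵥ y := by
    choose c hc0 hc using fun p => exists_coercive_kerOrthogonal (hHsemi p)
    obtain ⟨p₀, hp₀⟩ := Finite.exists_min c
    exact ⟨c p₀, hc0 p₀, fun p y hy => (mul_le_mul_of_nonneg_right (hp₀ p)
      (dotProduct_self_nonneg_real y)).trans (hc p y hy)⟩
  obtain ⟨L, hL⟩ := exists_gain (ν := Fin N) (eq_zero_of_obsvMatrix_rank hobsv) hτ hc0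
    (div_pos hε0 (one_pos.trans_le hM1))
  obtain ⟨b, hb⟩ : ∃ b, ∀ p, opNorm (F - Hmat p ⊗ₖ (L * C)) ≤ b := by
    obtain ⟨p, hp⟩ := Finite.exists_max fun p => opNorm (F - Hmat p ⊗ₖ (L * C))
    exact ⟨_, hp⟩
  have hb0 : 0 ≤ b := (opNorm_nonneg _).trans (hb (σ 0))
  refine ⟨L, Real.exp (b * Tc) * (θ⁻¹ * M), -(Real.log θ / Tc), by positivity,
    neg_pos.2 (div_neg_of_neg_of_pos (Real.log_neg hθ0 hθ1) hTc), fun η hη t ht => ?_⟩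
  have htsmono : Monotone ts := monotone_nat_of_le_succ fun r => by linarith [hdwell r]
  have hts0' : ∀ r, 0 ≤ ts r := fun r => hts0 ▸ htsmono (Nat.zero_le r)
  have hcont : ContinuousOn η (Set.Ici 0) := fun s hs => by
    obtain ⟨r, hr⟩ := exists_mem_Ico_of_le_sub hτ hts0 hdwell hs
    exact (hη r s hr).continuousWithinAt
  have hderiv : ∀ r, ∀ s ∈ Set.Ico (ts r) (ts (r + 1)), 0 < s →
      HasDerivAt η ((F - Hmat (σ r) ⊗ₖ (L * C)) *ᵥ η s) s := fun r s hs h0 =>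
    (hη r s hs).hasDerivAt (Ici_mem_nhds h0)
  have hstep : ∀ r, ∃ e, η (ts (r + 1)) = exp ((ts (r + 1) - ts r) • F) *ᵥ
      ((Pproj r ⊗ₖ (1 : Matrix (Fin n) (Fin n) ℝ)) *ᵥ η (ts r)) + e ∧
      f e ≤ ε * f (η (ts r)) := fun r => by
    have hHP : Hmat (σ r) * Pproj r = 0 := ext_of_mulVec_single fun i => by
      rw [← mulVec_mulVec, hPrange, zero_mulVec]
    obtain ⟨e, he, hle⟩ := hL (Hmat (σ r)) (Pproj r) (hc _) (hHsymm _) (hPsymm r) (hPidem r) hHP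
      (hPfix r) (ts r) (ts (r + 1)) η (by linarith [hdwell r])
      (hcont.mono fun s hs => (hts0' r).trans hs.1)
      fun s hs => hderiv r s ⟨hs.1.le, hs.2⟩ ((hts0' r).trans_lt hs.1)
    refine ⟨e, he, (hf2 e).trans ?_⟩
    calc M * eNorm e ≤ M * (ε / M * eNorm (η (ts r))) := by gcongr
      _ = ε * eNorm (η (ts r)) := by field_simp
      _ ≤ ε * f (η (ts r)) := by gcongr; exact hf1 _
  have hwindow : ∀ k, f (η (ts (j (k + 1)))) ≤ θ * f (η (ts (j k))) := fun k => by
    obtain ⟨d, hd⟩ := Nat.exists_eq_add_of_le (hjmono.monotone k.le_succ)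
    have hT := hTcb k
    have hδk := opNorm_le_of_eq_iSup hδ0 hδ k
    rw [hd] at hT hδk ⊢
    obtain ⟨-, e, he, hfe⟩ := exists_eq_exp_descProd_add (x := fun r => η (ts r)) hf0 hfz hfadd
      hα0.le hfexp
      (fun r x => by
        have h := hfQ (Pproj r ⊗ₖ (1 : Matrix (Fin n) (Fin n) ℝ)) 1 (commute_kronecker_one _ _)
          zero_le_one (fun x => by
            rw [one_mul]
            exact eNorm_mulVec_le_of_isSymm_of_idem
              (by rw [← kroneckerMap_transpose, hPsymm, transpose_one])
              (by rw [← mul_kronecker_mul, hPidem, one_mul]) x) x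
        rwa [one_mul] at h)
      (fun r => commute_kronecker_one _ _) hε0.le hε1 htsmono hstep (j k) d hT
    have hdR : d ≤ R := by
      have h := mul_natCast_le_of_le_sub hdwell (j k) d
      exact_mod_cast ((le_div_iff₀ hτ).2 (h.trans hT)).trans (Nat.le_ceil _)
    have hdS : d * (G₀ + 1) ^ d ≤ S := by
      rw [hS]
      gcongr
      linarith
    have hfree := hfexp _ (sub_nonneg.2 (htsmono (Nat.le_add_right (j k) d)))
      ((descProd Pproj (j k) (j k + d) ⊗ₖ (1 : Matrix (Fin n) (Fin n) ℝ)) *ᵥ η (ts (j k)))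
    have hproj := hfQ (descProd Pproj (j k) (j k + d) ⊗ₖ (1 : Matrix (Fin n) (Fin n) ℝ)) δ
      (commute_kronecker_one _ _) hδ0.le (fun x =>
        (eNorm_kronecker_one_mulVec_le _ x).trans
          (mul_le_mul_of_nonneg_right hδk (eNorm_nonneg x))) (η (ts (j k)))
    have hf := hf0 (η (ts (j k)))
    rw [descProd_kronecker_one] at he
    rw [he]
    calc _ ≤ G₀ * (δ * f (η (ts (j k)))) + ε * S * f (η (ts (j k))) := by
          refine (hfadd _ _).trans (add_le_add (hfree.trans ?_) (hfe.trans ?_))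
          · gcongr
            · exact hf0 _
            · rw [hG₀]
              gcongr
          · gcongr
      _ ≤ θ * f (η (ts (j k))) := by rw [hθ]; nlinarith
  have hgeom : ∀ k, f (η (ts (j k))) ≤ θ ^ k * (M * eNorm (η 0)) := fun k => by
    induction k with
    | zero => simpa [hj0, hts0] using hf2 (η 0)
    | succ k ih =>
      calc _ ≤ θ * f (η (ts (j k))) := hwindow k
        _ ≤ θ * (θ ^ k * (M * eNorm (η 0))) := by gcongr
        _ = _ := by ring
  have hjdwell : ∀ k, τ ≤ ts (j (k + 1)) - ts (j k) := fun k => by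
    linarith [hdwell (j k), htsmono (Nat.succ_le_of_lt (hjmono k.lt_succ_self))]
  obtain ⟨k, hk⟩ := exists_mem_Ico_of_le_sub (u := fun k => ts (j k)) hτ (by simp [hj0, hts0])
    hjdwell ht
  have hkT : ∀ k : ℕ, ts (j k) ≤ k * Tc := fun k => by
    induction k with
    | zero => simp [hj0, hts0]
    | succ k ih => push_cast; linarith [hTcb k]
  have htk : t ≤ (k + 1) * Tc := by
    have := hkT (k + 1)
    push_cast at this
    exact hk.2.le.trans this
  have hidx : ∀ s, ∃ r, 0 ≤ s → s ∈ Set.Ico (ts r) (ts (r + 1)) := fun s => by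
    by_cases hs : 0 ≤ s
    · exact (exists_mem_Ico_of_le_sub hτ hts0 hdwell hs).imp fun r hr _ => hr
    · exact ⟨0, fun h => absurd h hs⟩
  choose ρ hρ using hidx
  have hgrow := eNorm_le_exp_mul_of_linear (B := fun s => F - Hmat (σ (ρ s)) ⊗ₖ (L * C)) hk.1
    (hcont.mono fun s hs => (hts0' _).trans hs.1)
    (fun s hs => by
      have hs0 := (hts0' (j k)).trans_lt hs.1
      exact hderiv _ s (hρ s hs0.le) hs0) fun s _ => hb _
  have he0 := eNorm_nonneg (η 0)
  calc eNorm (η t) ≤ Real.exp (b * (t - ts (j k))) * eNorm (η (ts (j k))) := hgrow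
    _ ≤ Real.exp (b * Tc) * (θ ^ k * (M * eNorm (η 0))) := by
        gcongr
        · exact eNorm_nonneg _
        · linarith [hk.2, hTcb k]
        · exact (hf1 _).trans (hgeom k)
    _ ≤ Real.exp (b * Tc) *
          ((θ⁻¹ * Real.exp (Real.log θ / Tc * t)) * (M * eNorm (η 0))) := by
        gcongr
        exact pow_le_exp_of_le hθ0 hθ1 hTc htk
    _ = _ := by rw [neg_neg]; ring
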